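/- Let V be a valuation ring (a commutative ring whose ideals are totally ordered by inclusion, equivalently any two elements are comparable under divisibility). Then every unimodular row (f(x), g(x), e(x)) of length 3 over V[x] is equivalent under E₃(V[x]) to the row (1, 0, 0). -/

import Mathlib

open Matrix Polynomial

/-- The set of elementary matrices (transvections) over a commutative ring. -/
def ElemSet (ι R : Type) [Fintype ι] [DecidableEq ι] [CommRing R] :
    Set (Matrix ι ι R) :=
  { M | ∃ i j : ι, ∃ a : R, i ≠ j ∧ M = Matrix.transvection i j a }

/-- The elementary subgroup `E_n(R)`, as the multiplicative closure of the
elementary matrices (it is closed under inverses, hence a group). -/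
def Elem (ι R : Type) [Fintype ι] [DecidableEq ι] [CommRing R] :
    Submonoid (Matrix ι ι R) :=
  Submonoid.closure (ElemSet ι R)

/-- A row is unimodular if its entries generate the unit ideal. -/
def IsUnimodular {ι R : Type} [CommRing R] (v : ι → R) : Prop :=
  Ideal.span (Set.range v) = ⊤

/-- Two rows are equivalent under the elementary group if one is obtained from
the other by right multiplication by an element of `E_n(R)`. -/
def RowEquivE {ι R : Type} [Fintype ι] [DecidableEq ι] [CommRing R]
    (v w : ι → R) : Prop :=
  ∃ E ∈ Elem ι R, Matrix.vecMul v E = w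

theorem RowEquivE.trans {ι R : Type} [Fintype ι] [DecidableEq ι] [CommRing R]
    {u v w : ι → R} (huv : RowEquivE u v) (hvw : RowEquivE v w) : RowEquivE u w := by
  obtain ⟨E, hE, rfl⟩ := huv
  obtain ⟨F, hF, rfl⟩ := hvw
  exact ⟨E * F, mul_mem hE hF, by rw [Matrix.vecMul_vecMul]⟩

theorem rowEquivE_of_transvection {ι R : Type} [Fintype ι] [DecidableEq ι] [CommRing R]
    {v w : ι → R} (i j : ι) (hij : i ≠ j) (k : R)
    (h : Matrix.vecMul v (Matrix.transvection i j k) = w) : RowEquivE v w :=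
  ⟨_, Submonoid.subset_closure ⟨i, j, k, hij, rfl⟩, h⟩

section Triples

variable {R : Type} [CommRing R]

/-- Add a multiple of the first entry to each of the other two. -/
theorem rowEquivE_add_fst (a b c k l : R) :
    RowEquivE ![a, b, c] ![a, b + k * a, c + l * a] := by
  refine RowEquivE.trans (v := ![a, b + k * a, c])
    (rowEquivE_of_transvection 0 1 (by decide) k ?_)
    (rowEquivE_of_transvection 0 2 (by decide) l ?_) <;>
  · ext i
    fin_cases i <;>
      simp [Matrix.vecMul, dotProduct, Fin.sum_univ_three, Matrix.transvection,
        Matrix.single_apply, Matrix.one_apply]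
    ring

/-- Add multiples of the last two entries to the first one. -/
theorem rowEquivE_add_to_fst (a b c k l : R) :
    RowEquivE ![a, b, c] ![a + k * b + l * c, b, c] := by
  refine RowEquivE.trans (v := ![a + k * b, b, c])
    (rowEquivE_of_transvection 1 0 (by decide) k ?_)
    (rowEquivE_of_transvection 2 0 (by decide) l ?_) <;>
  · ext i
    fin_cases i <;>
      simp [Matrix.vecMul, dotProduct, Fin.sum_univ_three, Matrix.transvection,
        Matrix.single_apply, Matrix.one_apply]
    ring

/-- Add a multiple of the second entry to the last one. -/
theorem rowEquivE_add_snd_to_last (a b c k : R) :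
    RowEquivE ![a, b, c] ![a, b, c + k * b] := by
  refine rowEquivE_of_transvection 1 2 (by decide) k ?_
  ext i
  fin_cases i <;>
    simp [Matrix.vecMul, dotProduct, Fin.sum_univ_three, Matrix.transvection,
      Matrix.single_apply, Matrix.one_apply]
  ring

/-- Add a multiple of the last entry to the second one. -/
theorem rowEquivE_add_last_to_snd (a b c k : R) :
    RowEquivE ![a, b, c] ![a, b + k * c, c] := by
  refine rowEquivE_of_transvection 2 1 (by decide) k ?_
  ext i
  fin_cases i <;>
    simp [Matrix.vecMul, dotProduct, Fin.sum_univ_three, Matrix.transvection,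
      Matrix.single_apply, Matrix.one_apply]
  ring

theorem RowEquivE.congr_right {a b c a' b' c' a'' b'' c'' : R}
    (h : RowEquivE ![a, b, c] ![a', b', c']) (ha : a' = a'') (hb : b' = b'') (hc : c' = c'') :
    RowEquivE ![a, b, c] ![a'', b'', c''] := by
  subst ha hb hc; exact h

theorem rowEquivE_swap_neg (a b c : R) : RowEquivE ![a, b, c] ![a, c, -b] := by
  refine ((rowEquivE_add_last_to_snd a b c 1).trans
    ((rowEquivE_add_snd_to_last a _ c (-1)).trans
      (rowEquivE_add_last_to_snd a _ _ 1))).congr_right rfl ?_ ?_ <;> ring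

theorem rowEquivE_swap_neg_fst (a b c : R) : RowEquivE ![a, b, c] ![b, -a, c] := by
  refine ((rowEquivE_add_to_fst a b c 1 0).trans
    ((rowEquivE_add_fst _ b c (-1) 0).trans
      (rowEquivE_add_to_fst _ _ _ 1 0))).congr_right ?_ ?_ ?_ <;> ring

theorem rowEquivE_rotate (a b c : R) : RowEquivE ![a, b, c] ![c, a, b] := by
  refine ((rowEquivE_swap_neg a b c).trans ((rowEquivE_swap_neg_fst a c (-b)).trans
    ((rowEquivE_swap_neg _ _ _).trans ((rowEquivE_swap_neg _ _ _).trans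
      ?_))))
  simp only [neg_neg]
  exact (rowEquivE_add_fst c a b 0 0).congr_right rfl (by ring) (by ring)

/-- Congruence modulo the first entry. -/
theorem rowEquivE_of_dvd_sub {a b c b' c' : R} (hb : a ∣ b' - b) (hc : a ∣ c' - c) :
    RowEquivE ![a, b, c] ![a, b', c'] := by
  obtain ⟨k, hk⟩ := hb
  obtain ⟨l, hl⟩ := hc
  exact (rowEquivE_add_fst a b c k l).congr_right rfl
    (by linear_combination -hk) (by linear_combination -hl)

/-- Moving the last two entries in the direction orthogonal to a unimodularity certificate. -/
theorem rowEquivE_add_orthogonal (a b c x p q k : R) (h : x * a + p * b + q * c = 1) :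
    RowEquivE ![a, b, c] ![a, b - k * q, c + k * p] := by
  refine ((rowEquivE_add_to_fst a b c (k * p) (k * q)).trans
    ((rowEquivE_add_fst _ _ _ (-q) p).trans
    ((rowEquivE_add_to_fst _ _ _ (-(k * p)) (-(k * q))).trans
    ((rowEquivE_add_fst _ _ _ q (-p)).trans
    (rowEquivE_add_fst _ _ _ (-(k * x * q)) (k * x * p)))))).congr_right ?_ ?_ ?_
  · ring
  · linear_combination (-k * q) * h
  · linear_combination (k * p) * h

/-- A factor common to the last two entries and invertible modulo the first can be removed. -/
theorem rowEquivE_cancel {a b c s : R} (hs : IsCoprime s a)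
    (h : ∃ x p q, x * a + p * (s * b) + q * (s * c) = 1) :
    RowEquivE ![a, s * b, s * c] ![a, b, c] := by
  obtain ⟨t, r, hst⟩ := hs
  obtain ⟨x, p, q, h⟩ := h
  set B := s * b with hB
  set C := s * c with hC
  -- the pair `(B, C), (-q, p)` is acted on by a word for `diag (t, s)` in elementary matrices
  have h₂ : (x * (t * s) + r) * a + (-t * C) * (B - s * q) + (t * B) * (C + s * p) = 1 := by
    linear_combination (t * s) * h + hst
  have h₃ : (x * (t * s) + r) * a + (-t * C) * (-s * q) + (t * B) * (s * p) = 1 := by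
    linear_combination (t * s) * h + hst
  have h₄ : (x * (t * s) + r) * a + (s * p) * (-s * q - -1 * (t * B))
      + (s * q) * (s * p + -1 * (-t * C)) = 1 := by
    linear_combination (t * s) * h + hst
  refine (rowEquivE_add_orthogonal a B C x p q s h).trans
    ((rowEquivE_add_orthogonal a _ _ _ (-t * C) (t * B) s h₂).trans
    ((rowEquivE_of_dvd_sub (b' := -s * q) (c' := s * p) ⟨-r * B, ?_⟩ ⟨-r * C, ?_⟩).trans
    ((rowEquivE_add_orthogonal a _ _ _ (-t * C) (t * B) (-1) h₃).trans
    ((rowEquivE_add_orthogonal a _ _ _ (s * p) (s * q) (-1) h₄).trans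
    (rowEquivE_of_dvd_sub ⟨r * b, ?_⟩ ⟨r * c, ?_⟩)))))
  · linear_combination B * hst
  · linear_combination C * hst
  · linear_combination (-b) * hst - t * hB
  · linear_combination (-c) * hst - t * hC

end Triples

section Polynomials

variable {V : Type} [CommRing V]

theorem isCoprime_X_of_coeff_zero {f : V[X]} (hf : f.coeff 0 = 1) : IsCoprime X f := by
  refine ⟨-f.divX, 1, ?_⟩
  have h := f.divX_mul_X_add
  rw [hf, C_1] at h
  linear_combination -h

theorem natDegree_divX_sub_le {f g : V[X]} {m k : ℕ} (hf : f.natDegree ≤ k + 1)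
    (hg : g.natDegree ≤ m + 1) (hkm : k ≤ m) :
    (divX (g - C (g.coeff 0) * f)).natDegree ≤ m := by
  rw [natDegree_divX_eq_natDegree_tsub_one]
  have h₁ := natDegree_sub_le g (C (g.coeff 0) * f)
  have h₂ := natDegree_C_mul_le (g.coeff 0) f
  omega

theorem sub_eq_X_mul_divX {f : V[X]} (hf : f.coeff 0 = 1) (g : V[X]) :
    g - C (g.coeff 0) * f = X * divX (g - C (g.coeff 0) * f) := by
  conv_lhs => rw [← divX_mul_X_add (g - C (g.coeff 0) * f)]
  simp [hf, mul_comm]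

/-- Division by a polynomial with constant term `1`, starting from the constant terms. -/
theorem exists_dvd_sub_X_pow_mul {f : V[X]} {m : ℕ} (hf : f.coeff 0 = 1)
    (hfm : f.natDegree ≤ m + 1) (k : ℕ) (g : V[X]) (hg : g.natDegree ≤ m + k) :
    ∃ r : V[X], r.natDegree ≤ m ∧ f ∣ X ^ k * r - g := by
  induction k generalizing g with
  | zero => exact ⟨g, hg, by simp⟩
  | succ k ih =>
    obtain ⟨r, hr, d, hd⟩ := ih (divX (g - C (g.coeff 0) * f))
      (natDegree_divX_sub_le hfm hg (by omega))
    refine ⟨r, hr, X * d - C (g.coeff 0), ?_⟩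
    linear_combination X * hd - sub_eq_X_mul_divX hf g

/-- If `f` has constant term `1` and `g` has lower degree and a unit coefficient, then the
ideal they generate contains a polynomial of lower degree with constant term `1`. -/
theorem exists_coeff_zero_eq_one [IsLocalRing V] {f : V[X]} {m : ℕ} (hf : f.coeff 0 = 1)
    (hfm : f.natDegree ≤ m + 1) (i : ℕ) (g : V[X]) (hg : g.natDegree ≤ m)
    (hi : IsUnit (g.coeff i)) :
    ∃ u w : V[X], (u * f + w * g).natDegree ≤ m ∧ (u * f + w * g).coeff 0 = 1 := by
  induction i generalizing g with
  | zero =>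
    obtain ⟨v, hv⟩ := hi.exists_left_inv
    exact ⟨0, C v, by simpa using (natDegree_C_mul_le v g).trans hg, by simpa using hv⟩
  | succ i ih =>
    by_cases h₀ : IsUnit (g.coeff 0)
    · obtain ⟨v, hv⟩ := h₀.exists_left_inv
      exact ⟨0, C v, by simpa using (natDegree_C_mul_le v g).trans hg, by simpa using hv⟩
    · have hunit : IsUnit ((divX (g - C (g.coeff 0) * f)).coeff i) := by
        rw [coeff_divX, coeff_sub, coeff_C_mul]
        by_contra hn
        refine ((IsLocalRing.mem_maximalIdeal _).1 ?_) hi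
        have h₁ := (IsLocalRing.maximalIdeal V).mul_mem_right (f.coeff (i + 1))
          ((IsLocalRing.mem_maximalIdeal _).2 h₀)
        simpa using add_mem ((IsLocalRing.mem_maximalIdeal _).2 hn) h₁
      obtain ⟨u, w, hdeg, hone⟩ := ih _
        (natDegree_divX_sub_le hfm (hg.trans m.le_succ) le_rfl) hunit
      obtain ⟨t, r, htr⟩ := isCoprime_X_of_coeff_zero hf
      have h := sub_eq_X_mul_divX hf g
      set d := divX (g - C (g.coeff 0) * f)
      have key : (u + w * (r * d - t * C (g.coeff 0))) * f + w * t * g = u * f + w * d := by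
        linear_combination (w * t) * h + (w * d) * htr
      exact ⟨_, _, by rwa [key], by rwa [key]⟩

theorem exists_eq_C_mul_of_dvd_total (hV : ∀ a b : V, a ∣ b ∨ b ∣ a) (m : ℕ) (g : V[X])
    (hg : g.natDegree ≤ m) :
    ∃ (c : V) (p : V[X]), g = C c * p ∧ p.natDegree ≤ m ∧ ∃ i, IsUnit (p.coeff i) := by
  induction m generalizing g with
  | zero =>
    exact ⟨g.coeff 0, 1, by simpa using eq_C_of_natDegree_le_zero hg, by simp, 0, by simp⟩
  | succ m ih =>
    obtain ⟨c, p, hp, hpm, i, hi⟩ := ih g.divX (by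
      rw [natDegree_divX_eq_natDegree_tsub_one]; omega)
    have hdeg (a b : V) : (C a * p * X + C b).natDegree ≤ m + 1 :=
      natDegree_add_C.le.trans (natDegree_mul_le.trans
        (add_le_add ((natDegree_C_mul_le a p).trans hpm) natDegree_X_le))
    have h := g.divX_mul_X_add
    rcases hV c (g.coeff 0) with ⟨k, hk⟩ | ⟨k, hk⟩
    · refine ⟨c, C 1 * p * X + C k, ?_, hdeg 1 k, i + 1, by simpa using hi⟩
      rw [hk, hp, C_mul] at h
      rw [C_1]
      linear_combination -h
    · refine ⟨g.coeff 0, C k * p * X + C 1, ?_, hdeg k 1, 0, by simp⟩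
      rw [hp, hk, C_mul] at h
      rw [C_1]
      linear_combination -h

/-- Simultaneous extraction of the content of two polynomials. -/
theorem exists_common_content (hV : ∀ a b : V, a ∣ b ∨ b ∣ a) {m : ℕ} {g e : V[X]}
    (hg : g.natDegree ≤ m) (he : e.natDegree ≤ m) :
    ∃ (c : V) (p q : V[X]), g = C c * p ∧ e = C c * q ∧ p.natDegree ≤ m ∧ q.natDegree ≤ m ∧
      ((∃ i, IsUnit (p.coeff i)) ∨ ∃ i, IsUnit (q.coeff i)) := by
  obtain ⟨c, p, rfl, hp, hpi⟩ := exists_eq_C_mul_of_dvd_total hV m g hg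
  obtain ⟨d, q, rfl, hq, hqi⟩ := exists_eq_C_mul_of_dvd_total hV m e he
  rcases hV c d with ⟨k, rfl⟩ | ⟨k, rfl⟩
  · exact ⟨c, p, C k * q, rfl, by rw [C_mul, mul_assoc], hp,
      (natDegree_C_mul_le k q).trans hq, Or.inl hpi⟩
  · exact ⟨d, C k * p, q, by rw [C_mul, mul_assoc], rfl,
      (natDegree_C_mul_le k p).trans hp, hq, Or.inr hqi⟩

theorem rowEquivE_one_of_coeff_zero [IsLocalRing V] (hV : ∀ a b : V, a ∣ b ∨ b ∣ a) (m : ℕ)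
    (f g e : V[X]) (hfm : f.natDegree ≤ m) (hf : f.coeff 0 = 1)
    (h : ∃ x p q, x * f + p * g + q * e = 1) : RowEquivE ![f, g, e] ![1, 0, 0] := by
  induction m generalizing f g e with
  | zero =>
    obtain rfl : f = 1 := by rw [eq_C_of_natDegree_le_zero hfm, hf, C_1]
    exact rowEquivE_of_dvd_sub (one_dvd _) (one_dvd _)
  | succ m ih =>
    -- lower the degree once one of the last two entries has a unit coefficient
    have step (g e : V[X]) (hg : g.natDegree ≤ m) (he : e.natDegree ≤ m)
        (hi : ∃ i, IsUnit (g.coeff i)) (h : ∃ x p q, x * f + p * g + q * e = 1) :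
        RowEquivE ![f, g, e] ![1, 0, 0] := by
      obtain ⟨i, hi⟩ := hi
      obtain ⟨x, p, q, h⟩ := h
      obtain ⟨u, w, hdeg, hone⟩ := exists_coeff_zero_eq_one hf hfm i g hg hi
      set k : V[X] := C (1 - e.coeff 0) with hk
      have h₁ : RowEquivE ![f, g, e] ![f, g, e + k * (u * f + w * g)] :=
        ((rowEquivE_add_fst f g e 0 (k * u)).trans
          (rowEquivE_add_snd_to_last _ _ _ (k * w))).congr_right rfl (by ring) (by ring)
      refine h₁.trans ((rowEquivE_rotate _ _ _).trans (ih _ _ _ ?_ ?_ ?_))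
      · exact natDegree_add_le_of_degree_le he ((natDegree_C_mul_le _ _).trans hdeg)
      · rw [coeff_add, hk, coeff_C_mul, hone]; ring
      · exact ⟨q, x - q * k * u, p - q * k * w, by linear_combination h⟩
    obtain ⟨r, hr, a, ha⟩ := exists_dvd_sub_X_pow_mul hf hfm (g.natDegree + e.natDegree) g
      (by omega)
    obtain ⟨s, hs, b, hb⟩ := exists_dvd_sub_X_pow_mul hf hfm (g.natDegree + e.natDegree) e
      (by omega)
    obtain ⟨c, r', s', rfl, rfl, hr', hs', hunit⟩ := exists_common_content hV hr hs
    obtain ⟨x, p, q, h⟩ := h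
    set n := g.natDegree + e.natDegree
    have h₁ : (x - p * a - q * b) * f + p * (X ^ n * (C c * r')) + q * (X ^ n * (C c * s'))
        = 1 := by linear_combination h + p * ha + q * hb
    have hc : IsCoprime (C c) f :=
      ⟨p * X ^ n * r' + q * X ^ n * s', x - p * a - q * b, by linear_combination h₁⟩
    have h₂ : (x - p * a - q * b) * f + (p * X ^ n) * (C c * r') + (q * X ^ n) * (C c * s')
        = 1 := by linear_combination h₁
    have h₃ : (x - p * a - q * b) * f + (p * X ^ n * C c) * r' + (q * X ^ n * C c) * s'
        = 1 := by linear_combination h₁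
    refine (rowEquivE_of_dvd_sub ⟨a, ha⟩ ⟨b, hb⟩).trans
      ((rowEquivE_cancel (isCoprime_X_of_coeff_zero hf).pow_left ⟨_, _, _, h₁⟩).trans
      ((rowEquivE_cancel hc ⟨_, _, _, h₂⟩).trans ?_))
    rcases hunit with hunit | hunit
    · exact step _ _ hr' hs' hunit ⟨_, _, _, h₃⟩
    · exact (rowEquivE_swap_neg _ _ _).trans (step _ _ hs' (by rwa [natDegree_neg]) hunit
        ⟨x - p * a - q * b, q * X ^ n * C c, -(p * X ^ n * C c), by linear_combination h₃⟩)

theorem rowEquivE_one_of_isUnit_coeff_zero [IsLocalRing V] (hV : ∀ a b : V, a ∣ b ∨ b ∣ a)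
    (f g e : V[X]) (hf : IsUnit (f.coeff 0)) (h : ∃ x p q, x * f + p * g + q * e = 1) :
    RowEquivE ![f, g, e] ![1, 0, 0] := by
  obtain ⟨v, hv⟩ := hf.exists_left_inv
  obtain ⟨x, p, q, h⟩ := h
  set k : V[X] := C ((1 - e.coeff 0) * v) with hk
  refine (rowEquivE_add_fst f g e 0 k).trans ((rowEquivE_rotate _ _ _).trans
    (rowEquivE_one_of_coeff_zero hV _ _ _ _ le_rfl ?_
      ⟨q, x - q * k, p, by linear_combination h⟩))
  rw [coeff_add, hk, coeff_C_mul]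
  linear_combination (1 - e.coeff 0) * hv

theorem isLocalRing_of_dvd_total [Nontrivial V] (hV : ∀ a b : V, a ∣ b ∨ b ∣ a) :
    IsLocalRing V := by
  refine IsLocalRing.of_isUnit_or_isUnit_one_sub_self fun a => ?_
  rcases hV a (1 - a) with h | h
  · exact Or.inl (isUnit_of_dvd_one (by simpa using dvd_add h dvd_rfl))
  · exact Or.inr (isUnit_of_dvd_one (by simpa using dvd_add (dvd_refl (1 - a)) h))

end Polynomials

theorem stmt_5 {V : Type} [CommRing V] (hV : ∀ a b : V, a ∣ b ∨ b ∣ a)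
    (f g e : V[X]) (hum : IsUnimodular ![f, g, e]) :
    RowEquivE ![f, g, e] ![1, 0, 0] := by
  rcases subsingleton_or_nontrivial V with _ | _
  · exact ⟨1, one_mem _, Subsingleton.elim _ _⟩
  have := isLocalRing_of_dvd_total hV
  obtain ⟨x, p, q, h⟩ : ∃ x p q : V[X], x * f + p * g + q * e = 1 := by
    have h₁ : (1 : V[X]) ∈ Ideal.span (Set.range ![f, g, e]) := by
      rw [show Ideal.span (Set.range ![f, g, e]) = ⊤ from hum]; trivial
    obtain ⟨c, hc⟩ := Ideal.mem_span_range_iff_exists_fun.1 h₁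
    exact ⟨c 0, c 1, c 2, by simpa [Fin.sum_univ_three] using hc⟩
  have h₀ : IsUnit (x.coeff 0 * f.coeff 0 + p.coeff 0 * g.coeff 0 + q.coeff 0 * e.coeff 0) := by
    simpa using congrArg (fun r => IsUnit (coeff r 0)) h
  rcases IsLocalRing.isUnit_or_isUnit_of_isUnit_add h₀ with h₁ | h₁
  · rcases IsLocalRing.isUnit_or_isUnit_of_isUnit_add h₁ with h₂ | h₂
    · exact rowEquivE_one_of_isUnit_coeff_zero hV _ _ _ (isUnit_of_mul_isUnit_right h₂)
        ⟨x, p, q, h⟩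
    · exact ((rowEquivE_rotate _ _ _).trans (rowEquivE_rotate _ _ _)).trans
        (rowEquivE_one_of_isUnit_coeff_zero hV _ _ _ (isUnit_of_mul_isUnit_right h₂)
          ⟨p, q, x, by linear_combination h⟩)
  · exact (rowEquivE_rotate _ _ _).trans
      (rowEquivE_one_of_isUnit_coeff_zero hV _ _ _ (isUnit_of_mul_isUnit_right h₁)
        ⟨q, x, p, by linear_combination h⟩)
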